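/- Let q be a prime power and k ≥ 2. Every k-uniform local arc S in PG(2,q) satisfies k·|S| ≤ (4(k-1) + (3k-5)q + √(q·(8(k-1)(q²+k-2) − q(7k²−10k−1)))) / (2(k-1)), where |S| denotes the number of members of S. -/

import Mathlib

open Configuration Finset

section Incidence

variable {P L : Type*} [Membership P L] [Fintype L]
  [∀ (p : P) (l : L), Decidable (p ∈ l)] [ProjectivePlane P L]

theorem card_filter_lines_through [Finite P] (p : P) :
    (univ.filter fun l : L => p ∈ l).card = ProjectivePlane.order P L + 1 := by
  rw [← ProjectivePlane.lineCount_eq (L := L) p, lineCount, Nat.card_eq_fintype_card,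
    Fintype.card_subtype]

theorem card_filter_lines_through_pair {p p' : P} (h : p ≠ p') :
    (univ.filter fun l : L => p ∈ l ∧ p' ∈ l).card = 1 := by
  obtain ⟨l, hl, hu⟩ := HasLines.existsUnique_line P L p p' h
  rw [card_eq_one]
  refine ⟨l, ?_⟩
  ext m
  simp only [mem_filter, mem_univ, true_and, mem_singleton]
  exact ⟨hu m, fun hm => hm ▸ hl⟩

theorem sum_card_filter_mem [Finite P] (X : Finset P) :
    ∑ l : L, (X.filter (· ∈ l)).card = X.card * (ProjectivePlane.order P L + 1) := by
  simp only [card_filter]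
  rw [sum_comm]
  simp only [← card_filter, card_filter_lines_through, sum_const, smul_eq_mul]

theorem sum_card_filter_mem_sq [Finite P] (X : Finset P) :
    ∑ l : L, (X.filter (· ∈ l)).card ^ 2 =
      X.card * ProjectivePlane.order P L + X.card ^ 2 := by
  classical
  have hpair (p p' : P) : (univ.filter fun l : L => p ∈ l ∧ p' ∈ l).card =
      (if p = p' then ProjectivePlane.order P L else 0) + 1 := by
    split_ifs with h
    · simp [h, card_filter_lines_through]
    · simp [card_filter_lines_through_pair h]
  calc ∑ l : L, (X.filter (· ∈ l)).card ^ 2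
      = ∑ l : L, ∑ p ∈ X, ∑ p' ∈ X, if p ∈ l ∧ p' ∈ l then 1 else 0 := by
        simp only [card_filter, sq, sum_mul_sum, ite_and, mul_ite, mul_one, mul_zero]
        refine sum_congr rfl fun l _ => sum_congr rfl fun p _ => sum_congr rfl fun p' _ => ?_
        split_ifs <;> rfl
    _ = ∑ p ∈ X, ∑ p' ∈ X, (univ.filter fun l : L => p ∈ l ∧ p' ∈ l).card := by
        simp only [card_filter]
        rw [sum_comm]
        exact sum_congr rfl fun p _ => sum_comm
    _ = X.card * ProjectivePlane.order P L + X.card ^ 2 := by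
        simp only [hpair, sum_add_distrib, sum_ite_eq, sum_const, smul_eq_mul, mul_one]
        simp [sq]

/-- The number of secants of an arc with `k` points is `k(k-1)/2`. -/
theorem two_mul_card_secants [Finite P] {A : Finset P}
    (hA : ∀ l : L, (A.filter (· ∈ l)).card ≤ 2) :
    2 * ((univ.filter fun l : L => (A.filter (· ∈ l)).card = 2).card : ℝ) =
      A.card * (A.card - 1) := by
  have h₁ : (∑ l : L, ((A.filter (· ∈ l)).card : ℝ)) =
      A.card * (ProjectivePlane.order P L + 1) :=
    mod_cast sum_card_filter_mem (L := L) A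
  have h₂ : (∑ l : L, ((A.filter (· ∈ l)).card : ℝ) ^ 2) =
      A.card * ProjectivePlane.order P L + A.card ^ 2 :=
    mod_cast sum_card_filter_mem_sq (L := L) A
  have h : 2 * ((univ.filter fun l : L => (A.filter (· ∈ l)).card = 2).card : ℝ) =
      ∑ l : L, (((A.filter (· ∈ l)).card : ℝ) ^ 2 - (A.filter (· ∈ l)).card) := by
    rw [card_filter, Nat.cast_sum, mul_sum]
    refine sum_congr rfl fun l _ => ?_
    have := hA l
    generalize (A.filter (· ∈ l)).card = m at this ⊢
    interval_cases m <;> norm_num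
  rw [h, sum_sub_distrib, h₁, h₂]
  ring

/-- The expander mixing lemma in a projective plane, for a point set `X` and a set `T` of lines
all meeting `X` in the same number `m` of points. -/
theorem expander_mixing_of_card_eq [Fintype P] (X : Finset P) (T : Finset L) (m : ℕ)
    (hT : ∀ l ∈ T, (X.filter (· ∈ l)).card = m) {q N : ℝ}
    (hq : (ProjectivePlane.order P L : ℝ) = q) (hN : N = q ^ 2 + q + 1) :
    T.card * (N * m - (q + 1) * X.card) ^ 2 ≤
      q * X.card * (N - X.card) * (N - T.card) := by
  classical
  have hcardL : (Fintype.card L : ℝ) = N := by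
    rw [hN, ← hq, ProjectivePlane.card_lines P L]
    push_cast
    ring
  have hNpos : 0 < N := by
    rw [hN, ← hq]
    positivity
  have h₁ : (∑ l : L, ((X.filter (· ∈ l)).card : ℝ)) = X.card * (q + 1) := by
    rw [← hq]
    exact_mod_cast sum_card_filter_mem (L := L) X
  have h₂ : (∑ l : L, ((X.filter (· ∈ l)).card : ℝ) ^ 2) = X.card * q + X.card ^ 2 := by
    rw [← hq]
    exact_mod_cast sum_card_filter_mem_sq (L := L) X
  set x : ℝ := (X.card : ℝ)
  set f : L → ℝ := fun l => N * (X.filter (· ∈ l)).card - (q + 1) * x with hf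
  set c : ℝ := N * m - (q + 1) * x with hc
  have hfT : ∀ l ∈ T, f l = c := fun l hl => by simp only [hf, hc, hT l hl]
  have hsum : ∑ l, f l = 0 := by
    simp only [hf, sum_sub_distrib, ← mul_sum, h₁, sum_const, card_univ, nsmul_eq_mul, hcardL]
    ring
  have hsq : ∑ l, f l ^ 2 = N * (q * x * (N - x)) := by
    have hexp : ∀ l, f l ^ 2 = N ^ 2 * ((X.filter (· ∈ l)).card : ℝ) ^ 2
        - 2 * N * (q + 1) * x * (X.filter (· ∈ l)).card + ((q + 1) * x) ^ 2 := fun l => by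
      simp only [hf]
      ring
    simp only [hexp, sum_add_distrib, sum_sub_distrib, ← mul_sum, h₁, h₂, sum_const, card_univ,
      nsmul_eq_mul, hcardL]
    rw [hN]
    ring
  have hTsum : ∑ l ∈ T, f l = T.card * c := by
    rw [sum_congr rfl hfT, sum_const, nsmul_eq_mul]
  have hTsq : ∑ l ∈ T, f l ^ 2 = T.card * c ^ 2 := by
    rw [sum_congr rfl fun l hl => by rw [hfT l hl], sum_const, nsmul_eq_mul]
  have hCS := sq_sum_le_card_mul_sum_sq (s := Tᶜ) (f := f)
  have hcompl : ((Tᶜ).card : ℝ) = N - T.card := by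
    rw [card_compl, Nat.cast_sub (card_le_univ T), hcardL]
  rw [hcompl, eq_sub_of_add_eq' ((sum_add_sum_compl T f).trans hsum),
    eq_sub_of_add_eq' ((sum_add_sum_compl T fun l => f l ^ 2).trans hsq), hTsum, hTsq] at hCS
  refine le_of_mul_le_mul_left ?_ hNpos
  linarith

end Incidence

theorem le_of_quadratic_nonpos {a b c D x : ℝ} (ha : 0 < a) (hD : D = b ^ 2 - 4 * a * c)
    (h : a * x ^ 2 - b * x + c ≤ 0) : x ≤ (b + √D) / (2 * a) := by
  rw [le_div_iff₀ (by positivity)]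
  have : x * (2 * a) - b ≤ √D := Real.le_sqrt_of_sq_le (by rw [hD]; nlinarith)
  linarith



/-- **Upper bound on `k`-uniform local arcs.** In a projective plane of order `q` (a prime
power), every `k`-uniform local arc `𝒮` with `k ≥ 2` satisfies
`k·|𝒮| ≤ (4(k-1) + (3k-5)q + √(q(8(k-1)(q²+k-2) − q(7k²−10k−1)))) / (2(k-1))`. -/
theorem local_arc_upper_bound {P L : Type*} [Membership P L] [Fintype P] [Fintype L]
    [DecidableEq P] [DecidableEq L] [∀ (p : P) (l : L), Decidable (p ∈ l)]
    [ProjectivePlane P L] (q k : ℕ) (hq : IsPrimePow q)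
    (horder : ProjectivePlane.order P L = q) (hk : 2 ≤ k)
    (𝒮 : Finset (Finset P))
    (hcard : ∀ A ∈ 𝒮, A.card = k)
    (hdisj : ∀ A ∈ 𝒮, ∀ B ∈ 𝒮, A ≠ B → Disjoint A B)
    (harc : ∀ A ∈ 𝒮, ∀ B ∈ 𝒮, ∀ l : L, ((A ∪ B).filter (· ∈ l)).card ≤ 2) :
    (k : ℝ) * 𝒮.card ≤
      (4 * ((k : ℝ) - 1) + (3 * (k : ℝ) - 5) * q
          + Real.sqrt ((q : ℝ) * (8 * ((k : ℝ) - 1) * ((q : ℝ) ^ 2 + (k : ℝ) - 2)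
              - (q : ℝ) * (7 * (k : ℝ) ^ 2 - 10 * (k : ℝ) - 1))))
        / (2 * ((k : ℝ) - 1)) := by
  have hk1 : (0 : ℝ) < (k : ℝ) - 1 := by
    have : (2 : ℝ) ≤ k := mod_cast hk
    linarith
  have hX : ((𝒮.biUnion fun A => A).card : ℝ) = k * 𝒮.card := by
    rw [card_biUnion (fun A hA B hB hne => hdisj A hA B hB hne)]
    simp only [sum_congr rfl hcard, sum_const, smul_eq_mul]
    push_cast
    ring
  have harcSelf : ∀ A ∈ 𝒮, ∀ l : L, (A.filter (· ∈ l)).card ≤ 2 := fun A hA l => by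
    simpa using harc A hA A hA l
  have hsecant : ∀ A ∈ 𝒮, ∀ l : L, (A.filter (· ∈ l)).card = 2 → ∀ B ∈ 𝒮, A ≠ B →
      B.filter (· ∈ l) = ∅ := fun A hA l hl B hB hne => by
    have h := harc A hA B hB l
    rw [filter_union, card_union_of_disjoint
      (disjoint_filter_filter (hdisj A hA B hB hne)), hl] at h
    exact card_eq_zero.mp (by omega)
  set secants : Finset P → Finset L :=
    fun A => univ.filter fun l : L => (A.filter (· ∈ l)).card = 2 with hsecants
  have hT : 2 * ((𝒮.biUnion secants).card : ℝ) = k * 𝒮.card * (k - 1) := by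
    rw [card_biUnion, Nat.cast_sum, mul_sum,
      sum_congr rfl fun A hA => (two_mul_card_secants (harcSelf A hA)).trans
        (by rw [hcard A hA]), sum_const, nsmul_eq_mul]
    · ring
    · intro A hA B hB hne
      refine disjoint_left.mpr fun l hlA hlB => ?_
      simp only [hsecants, mem_filter, mem_univ, true_and] at hlA hlB
      simp [hsecant A hA l hlA B hB hne] at hlB
  have hmeet : ∀ l ∈ 𝒮.biUnion secants, ((𝒮.biUnion fun A => A).filter (· ∈ l)).card = 2 := by
    intro l hl
    simp only [hsecants, mem_biUnion, mem_filter, mem_univ, true_and] at hl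
    obtain ⟨A, hA, hlA⟩ := hl
    rw [← hlA]
    congr 1
    ext p
    simp only [mem_filter, mem_biUnion]
    refine ⟨?_, fun h => ⟨⟨A, hA, h.1⟩, h.2⟩⟩
    rintro ⟨⟨B, hB, hpB⟩, hpl⟩
    by_cases hne : A = B
    · exact ⟨hne ▸ hpB, hpl⟩
    · have hp : p ∈ B.filter (· ∈ l) := mem_filter.mpr ⟨hpB, hpl⟩
      simp [hsecant A hA l hlA B hB hne] at hp
  have hmix := expander_mixing_of_card_eq (𝒮.biUnion fun A => A) (𝒮.biUnion secants) 2 hmeet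
    (q := q) (by rw [horder]) rfl
  rw [hX] at hmix
  have hq0 : (0 : ℝ) ≤ q := by positivity
  have hx0 : (0 : ℝ) ≤ k * 𝒮.card := by positivity
  generalize (k : ℝ) * 𝒮.card = x at hT hmix hx0 ⊢
  rcases hx0.eq_or_lt with rfl | hx
  · have : (0 : ℝ) ≤ 3 * k - 5 := by
      have : (2 : ℝ) ≤ k := mod_cast hk
      linarith
    positivity
  refine le_of_quadratic_nonpos
    (c := ((q : ℝ) ^ 2 + q + 1) * (4 * ((k : ℝ) - 1) - 2 * q)) hk1 (by ring) ?_
  obtain hT : ((𝒮.biUnion secants).card : ℝ) = x * (k - 1) / 2 := by linarith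
  rw [hT] at hmix
  have hN : (0 : ℝ) < (q : ℝ) ^ 2 + q + 1 := by positivity
  refine nonpos_of_mul_nonpos_right (a := x * ((q : ℝ) ^ 2 + q + 1)) ?_ (by positivity)
  push_cast at hmix
  linarith
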